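/- Fix integers N ≥ 2 and 1 ≤ K ≤ N − 1, and for p₀ ∈ (0, p_*) let (q₁(p₀;K), q_N(p₀;K)) be the unique pair with q₁ > 0way and q_N ∈ (0, √A(p₀)) solving T₊(p₀, q₁) = T₋(p₀, q_N) and 2K q₁ − 2(N − K) q_N = √A(p₀). Then the maps p₀ ↦ q₁(p₀;K), p₀ ↦ q_N(p₀;K), and p₀ ↦ T₊(p₀, q₁(p₀;K)) are continuously differentiable on (0, p_*). -/

import Mathlib

open Real MeasureTheory Set Filter Topology

/-- The potential `A(u) = u²(1 − u²)`. -/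
noncomputable def A (u : ℝ) : ℝ := u ^ 2 * (1 - u ^ 2)

/-- `p⋆ = 1/√2`, the unique positive critical point of `A`, with `A p⋆ = 1/4`. -/
noncomputable def pstar : ℝ := 1 / Real.sqrt 2

/-- For energy `E > −1/4`, the unique root `p₊ > p⋆` of `A(p₊) = −E` (explicit formula). -/
noncomputable def pPlus (E : ℝ) : ℝ := Real.sqrt ((1 + Real.sqrt (1 + 4 * E)) / 2)

/-- For energy `E ∈ (−1/4, 0)`, the unique root `p₋ ∈ (0, p⋆)` of `A(p₋) = −E` (explicit formula). -/
noncomputable def pMinus (E : ℝ) : ℝ := Real.sqrt ((1 - Real.sqrt (1 + 4 * E)) / 2)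

/-- The period function `T₊(p₀,q₀) = ∫_{p₀}^{p₊} du/√(E + A(u))`, `E = q₀² − A(p₀)`. -/
noncomputable def Tplus (p₀ q₀ : ℝ) : ℝ :=
  ∫ u in p₀..pPlus (q₀ ^ 2 - A p₀), 1 / Real.sqrt ((q₀ ^ 2 - A p₀) + A u)

/-- The period function `T₋(p₀,q₀) = ∫_{p₋}^{p₀} du/√(E + A(u))`, `E = q₀² − A(p₀)`. -/
noncomputable def Tminus (p₀ q₀ : ℝ) : ℝ :=
  ∫ u in pMinus (q₀ ^ 2 - A p₀)..p₀, 1 / Real.sqrt ((q₀ ^ 2 - A p₀) + A u)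

/-- The reciprocal-square-root weight `1 / (2√y)` on `[m, ∞)` extends to a `C¹` function on `ℝ`. -/
lemma exists_contDiff_extension_inv_sqrt {m : ℝ} (hm : 0 < m) :
    ∃ φ : ℝ → ℝ, ContDiff ℝ 1 φ ∧ (∀ y, m ≤ y → φ y = 1 / (2 * √y)) ∧
      ∀ y, m < y → deriv φ y ≤ 0 := by
  let χ : ℝ → ℝ := fun y => Real.smoothTransition ((y - m / 2) / (m / 2))
  have hχ : ContDiff ℝ 1 χ := by
    have h : ContDiff ℝ 1 Real.smoothTransition := Real.smoothTransition.contDiff (n := 1)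
    exact h.comp (by fun_prop)
  have hpos : ∀ y, 0 < χ y * y + (1 - χ y) := by
    intro y
    rcases le_or_gt y (m / 2) with h | h
    · have : χ y = 0 := Real.smoothTransition.zero_of_nonpos
        (div_nonpos_of_nonpos_of_nonneg (by linarith) (by linarith))
      simp [this]
    · have h0 : 0 ≤ χ y := Real.smoothTransition.nonneg _
      have h1 : χ y ≤ 1 := Real.smoothTransition.le_one _
      rcases h0.eq_or_lt with h2 | h2
      · rw [← h2]; norm_num
      · have : 0 < χ y * y := mul_pos h2 (by linarith)
        linarith
  have hone : ∀ y, m ≤ y → χ y = 1 := fun y hy =>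
    Real.smoothTransition.one_of_one_le (by rw [le_div_iff₀ (by linarith)]; linarith)
  have heq : ∀ y, m ≤ y → 1 / (2 * √(χ y * y + (1 - χ y))) = 1 / (2 * √y) := by
    intro y hy
    simp [hone y hy]
  refine ⟨fun y => 1 / (2 * √(χ y * y + (1 - χ y))), ?_, heq, ?_⟩
  · refine contDiff_const.div (contDiff_const.mul (ContDiff.sqrt (by fun_prop)
      fun y => (hpos y).ne')) fun y => ?_
    have := Real.sqrt_pos.2 (hpos y)
    positivity
  · intro y hy
    rw [← derivWithin_of_isOpen isOpen_Ioi (show y ∈ Set.Ioi m from hy)]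
    refine AntitoneOn.derivWithin_nonpos fun a ha b hb hab => ?_
    have ha' : m < a := ha
    have hb' : m < b := hb
    simp only [heq a ha'.le, heq b hb'.le]
    have : 0 < √a := Real.sqrt_pos.2 (hm.trans ha')
    have := Real.sqrt_le_sqrt hab
    gcongr

lemma continuous_parametric_primitive {h : ℝ → ℝ → ℝ} {c : ℝ} (hc : Continuous ↿h) :
    Continuous fun z : ℝ × ℝ => ∫ θ in c..z.2, h z.1 θ :=
  intervalIntegral.continuous_parametric_intervalIntegral_of_continuous
    (f := fun z : ℝ × ℝ => h z.1)
    (hc.comp (by fun_prop : Continuous fun w : (ℝ × ℝ) × ℝ => (w.1.1, w.2))) continuous_snd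

/-- The primitive `∫_c^x h(d, θ) dθ` as a function of the parameter `d` and of the endpoint `x`. -/
lemma hasStrictFDerivAt_parametric_primitive {h h' : ℝ → ℝ → ℝ} {c : ℝ}
    (hc : Continuous ↿h) (hc' : Continuous ↿h')
    (hd : ∀ d θ, HasDerivAt (fun d => h d θ) (h' d θ) d) (z : ℝ × ℝ) :
    HasStrictFDerivAt (fun z : ℝ × ℝ => ∫ θ in c..z.2, h z.1 θ)
      ((∫ θ in c..z.2, h' z.1 θ) • ContinuousLinearMap.fst ℝ ℝ ℝ +
        h z.1 z.2 • ContinuousLinearMap.snd ℝ ℝ ℝ) z := by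
  have h1 : ∀ d, Continuous (h d) := fun d => hc.comp (Continuous.prodMk_right d)
  have h1' : ∀ d, Continuous (h' d) := fun d => hc'.comp (Continuous.prodMk_right d)
  have key := hasStrictFDerivAt_uncurry_coprod (u := z) (f := fun d x => ∫ θ in c..x, h d θ)
    (f₁ := fun d x => (∫ θ in c..x, h' d θ) • ContinuousLinearMap.id ℝ ℝ)
    (f₂ := fun d x => h d x • ContinuousLinearMap.id ℝ ℝ) ?_ ?_ ?_ ?_
  · refine key.congr_fderiv ?_
    ext <;> simp [Function.HasUncurry.uncurry]
  · refine Filter.Eventually.of_forall fun v => ?_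
    suffices H : HasDerivAt (fun d => ∫ θ in c..v.2, h d θ) (∫ θ in c..v.2, h' v.1 θ) v.1 by
      refine H.hasFDerivAt.congr_fderiv ?_
      ext
      simp [Function.HasUncurry.uncurry]
    obtain ⟨C, hC⟩ := ((isCompact_closedBall v.1 1).prod
      (isCompact_uIcc (a := c) (b := v.2))).exists_bound_of_continuousOn hc'.continuousOn
    refine (intervalIntegral.hasDerivAt_integral_of_dominated_loc_of_deriv_le
      (bound := fun _ => C) (Metric.closedBall_mem_nhds v.1 one_pos) ?_ ?_ ?_ ?_ ?_ ?_).2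
    · exact Filter.Eventually.of_forall fun d => (h1 d).aestronglyMeasurable
    · exact (h1 _).intervalIntegrable _ _
    · exact (h1' _).aestronglyMeasurable
    · exact Filter.Eventually.of_forall fun t ht d hd => hC (d, t) ⟨hd, Set.uIoc_subset_uIcc ht⟩
    · exact intervalIntegrable_const
    · exact Filter.Eventually.of_forall fun t _ d _ => hd d t
  · refine Filter.Eventually.of_forall fun v => ?_
    refine ((h1 v.1).integral_hasStrictDerivAt c v.2).hasDerivAt.hasFDerivAt.congr_fderiv ?_
    ext
    simp [Function.HasUncurry.uncurry]
  · exact ((continuous_parametric_primitive hc').smul continuous_const).continuousAt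
  · exact (hc.smul continuous_const).continuousAt

lemma contDiff_parametric_primitive {h h' : ℝ → ℝ → ℝ} {c : ℝ}
    (hc : Continuous ↿h) (hc' : Continuous ↿h')
    (hd : ∀ d θ, HasDerivAt (fun d => h d θ) (h' d θ) d) :
    ContDiff ℝ 1 (fun z : ℝ × ℝ => ∫ θ in c..z.2, h z.1 θ) := by
  refine contDiff_one_iff_hasFDerivAt.2
    ⟨_, ?_, fun z => (hasStrictFDerivAt_parametric_primitive hc hc' hd z).hasFDerivAt⟩
  exact ((continuous_parametric_primitive hc').smul continuous_const).add
    (hc.smul continuous_const)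

/-- Substituting `u = √(1/2 + d sin θ)` in the period integral at energy `d² − 1/4`. -/
lemma integral_energy_eq_integral_angle {d α β E : ℝ} (hd : 0 < d) (hα : -(π / 2) ≤ α)
    (hαβ : α ≤ β) (hβ : β ≤ π / 2) (hpos : 0 < 1 / 2 + d * sin α) (hE : E = d ^ 2 - 1 / 4) :
    ∫ u in √(1 / 2 + d * sin α)..√(1 / 2 + d * sin β), 1 / √(E + A u) =
      ∫ θ in α..β, 1 / (2 * √(1 / 2 + d * sin θ)) := by
  have hmono : ∀ θ ∈ Set.Icc α β, sin α ≤ sin θ := fun θ hθ =>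
    Real.sin_le_sin_of_le_of_le_pi_div_two hα (hθ.2.trans hβ) hθ.1
  have hpos' : ∀ θ ∈ Set.Icc α β, 0 < 1 / 2 + d * sin θ := fun θ hθ =>
    hpos.trans_le (by have := hmono θ hθ; gcongr)
  have hcos : ∀ θ ∈ Set.Ioo α β, 0 < cos θ := fun θ hθ =>
    Real.cos_pos_of_mem_Ioo ⟨hα.trans_lt hθ.1, hθ.2.trans_le hβ⟩
  have key := integral_Icc_deriv_smul_of_deriv_nonneg (a := α) (b := β)
    (f := fun θ => √(1 / 2 + d * sin θ))
    (f' := fun θ => d * cos θ / (2 * √(1 / 2 + d * sin θ)))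
    (g := fun u => 1 / √(E + A u)) (by fun_prop)
    (fun θ hθ => HasDerivAt.sqrt (((Real.hasDerivAt_sin θ).const_mul d).const_add _)
      (hpos' θ (Set.Ioo_subset_Icc_self hθ)).ne')
    (fun θ hθ => by have := hcos θ hθ; positivity) hαβ
  have hle : √(1 / 2 + d * sin α) ≤ √(1 / 2 + d * sin β) :=
    Real.sqrt_le_sqrt (by have := hmono β ⟨hαβ, le_rfl⟩; gcongr)
  rw [intervalIntegral.integral_of_le hle, intervalIntegral.integral_of_le hαβ,
    ← integral_Icc_eq_integral_Ioc, ← key, integral_Icc_eq_integral_Ioo,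
    integral_Ioc_eq_integral_Ioo]
  refine setIntegral_congr_fun measurableSet_Ioo fun θ hθ => ?_
  have h1 := hpos' θ (Set.Ioo_subset_Icc_self hθ)
  have h2 := hcos θ hθ
  have h3 : E + A (√(1 / 2 + d * sin θ)) = (d * cos θ) ^ 2 := by
    rw [A, Real.sq_sqrt h1.le, hE, mul_pow, Real.cos_sq']
    ring
  have h4 : 0 < √(1 / 2 + d * sin θ) := Real.sqrt_pos.2 h1
  simp only [h3, smul_eq_mul]
  rw [Real.sqrt_sq (by positivity)]
  field_simp

/-- The polar radius of the point `(q, p² − 1/2)`. -/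
noncomputable def polarRadius (p q : ℝ) : ℝ := √(q ^ 2 + (p ^ 2 - 1 / 2) ^ 2)

/-- The polar angle of the point `(q, p² − 1/2)`, for `q > 0`. -/
noncomputable def polarAngle (p q : ℝ) : ℝ := arctan ((p ^ 2 - 1 / 2) / q)

lemma polarRadius_sq (p q : ℝ) : polarRadius p q ^ 2 = q ^ 2 + (p ^ 2 - 1 / 2) ^ 2 :=
  Real.sq_sqrt (by positivity)

lemma polarRadius_nonneg (p q : ℝ) : 0 ≤ polarRadius p q :=
  Real.sqrt_nonneg _

lemma polarRadius_pos (p : ℝ) {q : ℝ} (hq : 0 < q) : 0 < polarRadius p q :=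
  Real.sqrt_pos.2 (by positivity)

lemma sqrt_one_add_div_sq (p : ℝ) {q : ℝ} (hq : 0 < q) :
    √(1 + ((p ^ 2 - 1 / 2) / q) ^ 2) = polarRadius p q / q := by
  rw [eq_div_iff hq.ne', polarRadius]
  nth_rw 2 [← Real.sqrt_sq hq.le]
  rw [← Real.sqrt_mul (by positivity)]
  congr 1
  field_simp

lemma polarRadius_mul_cos (p : ℝ) {q : ℝ} (hq : 0 < q) :
    polarRadius p q * cos (polarAngle p q) = q := by
  have := (polarRadius_pos p hq).ne'
  rw [polarAngle, Real.cos_arctan, sqrt_one_add_div_sq p hq]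
  field_simp

lemma polarRadius_mul_sin (p : ℝ) {q : ℝ} (hq : 0 < q) :
    polarRadius p q * sin (polarAngle p q) = p ^ 2 - 1 / 2 := by
  have := (polarRadius_pos p hq).ne'
  rw [polarAngle, Real.sin_arctan, sqrt_one_add_div_sq p hq]
  field_simp

lemma contDiffAt_polar (z : ℝ × ℝ) (hq : 0 < z.2) :
    ContDiffAt ℝ 1 (fun z : ℝ × ℝ => (polarRadius z.1 z.2, polarAngle z.1 z.2)) z := by
  refine ContDiffAt.prodMk (ContDiffAt.sqrt (by fun_prop) (by positivity)) ?_
  exact (Real.contDiff_arctan.contDiffAt).comp z (ContDiffAt.div (by fun_prop) (by fun_prop) hq.ne')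

lemma hasDerivAt_polar (p : ℝ) {q : ℝ} (hq : 0 < q) :
    HasDerivAt (fun q => (polarRadius p q, polarAngle p q))
      (cos (polarAngle p q), -sin (polarAngle p q) / polarRadius p q) q := by
  have hr := polarRadius_pos p hq
  have hc := polarRadius_mul_cos p hq
  have hs := polarRadius_mul_sin p hq
  have hsq := polarRadius_sq p q
  refine HasDerivAt.prodMk ?_ ?_
  · have h := (((hasDerivAt_pow 2 q).add_const ((p ^ 2 - 1 / 2) ^ 2))).sqrt (by positivity)
    refine h.congr_deriv ?_
    change _ / (2 * polarRadius p q) = _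
    rw [div_eq_iff (by positivity)]
    push_cast
    linear_combination -2 * hc
  · have h := (((hasDerivAt_const q (p ^ 2 - 1 / 2)).div (hasDerivAt_id q) hq.ne')).arctan
    refine h.congr_deriv ?_
    have h1 : 1 + ((p ^ 2 - 1 / 2) / q) ^ 2 = polarRadius p q ^ 2 / q ^ 2 := by
      rw [hsq]; field_simp
    simp only [Pi.div_apply, id]
    rw [h1, ← hs]
    field_simp
    ring

/-- Positivity, for `-π/2 < θ₀ < 0`, of the expression giving `-∂T₊/∂q` in polar coordinates. -/
lemma upper_angular_deriv_pos {φ : ℝ → ℝ} (hφ : ContDiff ℝ 1 φ) {d θ₀ : ℝ} (hd : 0 < d)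
    (hθ₀ : -(π / 2) < θ₀) (hθ₀' : θ₀ < 0)
    (hanti : ∀ y, 1 / 2 + d * sin θ₀ ≤ y → deriv φ y ≤ 0) (hpos : 0 < φ (1 / 2 + d)) :
    0 < (∫ θ in π / 2..θ₀, sin θ * deriv φ (1 / 2 + d * sin θ)) * cos θ₀ +
      φ (1 / 2 + d * sin θ₀) * (-sin θ₀ / d) := by
  have hpi := Real.pi_pos
  have hdφ : Continuous (deriv φ) := hφ.continuous_deriv le_rfl
  have hsin : sin θ₀ < 0 := Real.sin_neg_of_neg_of_neg_pi_lt hθ₀' (by linarith)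
  have hftc : ∫ θ in θ₀..π / 2, deriv φ (1 / 2 + d * sin θ) * (d * cos θ) =
      φ (1 / 2 + d) - φ (1 / 2 + d * sin θ₀) := by
    rw [intervalIntegral.integral_eq_sub_of_hasDerivAt (f := fun θ => φ (1 / 2 + d * sin θ))]
    · simp
    · intro θ _
      exact ((hφ.differentiable one_ne_zero _).hasDerivAt).comp θ
        (((Real.hasDerivAt_sin θ).const_mul d).const_add _)
    · exact Continuous.intervalIntegrable (by fun_prop) _ _
  have hmono : ∫ θ in θ₀..π / 2, (d * cos θ₀) * (sin θ * deriv φ (1 / 2 + d * sin θ)) ≤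
      ∫ θ in θ₀..π / 2, sin θ₀ * (deriv φ (1 / 2 + d * sin θ) * (d * cos θ)) := by
    refine intervalIntegral.integral_mono_on (by linarith)
      (Continuous.intervalIntegrable (by fun_prop) _ _)
      (Continuous.intervalIntegrable (by fun_prop) _ _) fun θ hθ => ?_
    have h1 : deriv φ (1 / 2 + d * sin θ) ≤ 0 := by
      refine hanti _ ?_
      have := Real.sin_le_sin_of_le_of_le_pi_div_two hθ₀.le hθ.2 hθ.1
      gcongr
    have h2 : 0 ≤ sin (θ - θ₀) :=
      Real.sin_nonneg_of_nonneg_of_le_pi (by linarith [hθ.1]) (by linarith [hθ.2])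
    rw [Real.sin_sub] at h2
    nlinarith [mul_nonneg hd.le (mul_nonneg h2 (neg_nonneg.2 h1))]
  rw [intervalIntegral.integral_const_mul, intervalIntegral.integral_const_mul, hftc] at hmono
  rw [intervalIntegral.integral_symm]
  refine (mul_pos_iff_of_pos_left hd).1 ?_
  have h3 : 0 < -sin θ₀ * φ (1 / 2 + d) := mul_pos (by linarith) hpos
  have h4 : d * (φ (1 / 2 + d * sin θ₀) * (-sin θ₀ / d)) = -(φ (1 / 2 + d * sin θ₀) * sin θ₀) := by
    field_simp
  rw [mul_add, h4]
  linarith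

/-- Positivity, for `-π/2 < θ₀ < 0`, of the expression giving `∂T₋/∂q` in polar coordinates. -/
lemma lower_angular_deriv_pos {φ : ℝ → ℝ} {d θ₀ : ℝ} (hd : 0 < d)
    (hθ₀ : -(π / 2) < θ₀) (hθ₀' : θ₀ < 0)
    (hanti : ∀ y, 1 / 2 - d ≤ y → deriv φ y ≤ 0) (hpos : 0 < φ (1 / 2 + d * sin θ₀)) :
    0 < (∫ θ in -(π / 2)..θ₀, sin θ * deriv φ (1 / 2 + d * sin θ)) * cos θ₀ +
      φ (1 / 2 + d * sin θ₀) * (-sin θ₀ / d) := by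
  have hpi := Real.pi_pos
  have hsin : sin θ₀ < 0 := Real.sin_neg_of_neg_of_neg_pi_lt hθ₀' (by linarith)
  have hcos : 0 < cos θ₀ := Real.cos_pos_of_mem_Ioo ⟨hθ₀, by linarith⟩
  refine add_pos_of_nonneg_of_pos (mul_nonneg ?_ hcos.le)
    (mul_pos hpos (div_pos (by linarith) hd))
  refine intervalIntegral.integral_nonneg hθ₀.le fun θ hθ => mul_nonneg_of_nonpos_of_nonpos
    (Real.sin_nonpos_of_nonpos_of_neg_pi_le (by linarith [hθ.2]) (by linarith [hθ.1]))
    (hanti _ ?_)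
  nlinarith [Real.neg_one_le_sin θ]

lemma pstar_sq : pstar ^ 2 = 1 / 2 := by
  rw [pstar, div_pow, Real.sq_sqrt (by norm_num)]
  norm_num

lemma sq_lt_half {p : ℝ} (hp : p ∈ Set.Ioo 0 pstar) : p ^ 2 < 1 / 2 := by
  rw [← pstar_sq]
  have := hp.1
  have := hp.2
  gcongr

lemma A_pos {p : ℝ} (hp : p ∈ Set.Ioo 0 pstar) : 0 < A p := by
  have := sq_lt_half hp
  have := hp.1
  exact mul_pos (by positivity) (by linarith)

lemma energy_eq (p q : ℝ) : q ^ 2 - A p = polarRadius p q ^ 2 - 1 / 4 := by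
  rw [polarRadius_sq, A]
  ring

lemma sqrt_one_add_four_mul_energy (p q : ℝ) :
    √(1 + 4 * (q ^ 2 - A p)) = 2 * polarRadius p q := by
  rw [energy_eq, show 1 + 4 * (polarRadius p q ^ 2 - 1 / 4) = (2 * polarRadius p q) ^ 2 by ring,
    Real.sqrt_sq (mul_nonneg zero_le_two (polarRadius_nonneg p q))]

lemma polarAngle_mem {p q : ℝ} (hp : p ∈ Set.Ioo 0 pstar) (hq : 0 < q) :
    -(π / 2) < polarAngle p q ∧ polarAngle p q < 0 :=
  ⟨Real.neg_pi_div_two_lt_arctan _,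
    Real.arctan_lt_zero.2 (div_neg_of_neg_of_pos (by linarith [sq_lt_half hp]) hq)⟩

lemma half_add_mul_sin_polarAngle (p : ℝ) {q : ℝ} (hq : 0 < q) :
    1 / 2 + polarRadius p q * sin (polarAngle p q) = p ^ 2 := by
  rw [polarRadius_mul_sin p hq]
  ring

lemma Tplus_eq {p q : ℝ} (hp : p ∈ Set.Ioo 0 pstar) (hq : 0 < q) :
    Tplus p q = ∫ θ in polarAngle p q..π / 2, 1 / (2 * √(1 / 2 + polarRadius p q * sin θ)) := by
  have hp0 := hp.1
  obtain ⟨h1, h2⟩ := polarAngle_mem hp hq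
  have hpi := Real.pi_pos
  rw [← integral_energy_eq_integral_angle (polarRadius_pos p hq) h1.le (by linarith) le_rfl
    (by rw [half_add_mul_sin_polarAngle p hq]; positivity) (energy_eq p q), Tplus,
    half_add_mul_sin_polarAngle p hq, Real.sqrt_sq hp0.le, pPlus, sqrt_one_add_four_mul_energy,
    Real.sin_pi_div_two]
  congr 2
  ring

lemma Tminus_eq {p q : ℝ} (hp : p ∈ Set.Ioo 0 pstar) (hq : 0 < q)
    (hlt : polarRadius p q < 1 / 2) :
    Tminus p q =
      ∫ θ in -(π / 2)..polarAngle p q, 1 / (2 * √(1 / 2 + polarRadius p q * sin θ)) := by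
  have hp0 := hp.1
  obtain ⟨h1, h2⟩ := polarAngle_mem hp hq
  have hpi := Real.pi_pos
  have hsin : sin (-(π / 2)) = -1 := by simp
  rw [← integral_energy_eq_integral_angle (polarRadius_pos p hq) le_rfl h1.le (by linarith)
    (by rw [hsin]; linarith) (energy_eq p q), Tminus,
    half_add_mul_sin_polarAngle p hq, Real.sqrt_sq hp0.le, pMinus, sqrt_one_add_four_mul_energy,
    hsin]
  congr 2
  ring

lemma polarRadius_lt_half {p q : ℝ} (hq : q ∈ Set.Ioo 0 √(A p)) : polarRadius p q < 1 / 2 := by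
  have h := (Real.lt_sqrt hq.1.le).1 hq.2
  have := energy_eq p q
  refine lt_of_pow_lt_pow_left₀ 2 (by norm_num) ?_
  linarith

/-- Regularity of angular integrals pulled back by polar coordinates. -/
lemma angular_integral_contDiffAt_hasDerivAt {φ : ℝ → ℝ} (hφ : ContDiff ℝ 1 φ) (c : ℝ)
    (p : ℝ) {q : ℝ} (hq : 0 < q) :
    ContDiffAt ℝ 1 (fun z : ℝ × ℝ =>
      ∫ θ in c..polarAngle z.1 z.2, φ (1 / 2 + polarRadius z.1 z.2 * sin θ)) (p, q) ∧
    HasDerivAt (fun q => ∫ θ in c..polarAngle p q, φ (1 / 2 + polarRadius p q * sin θ))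
      ((∫ θ in c..polarAngle p q, sin θ * deriv φ (1 / 2 + polarRadius p q * sin θ)) *
          cos (polarAngle p q) +
        φ (1 / 2 + polarRadius p q * sin (polarAngle p q)) *
          (-sin (polarAngle p q) / polarRadius p q)) q := by
  have hdφ : Continuous (deriv φ) := hφ.continuous_deriv le_rfl
  have hφc := hφ.continuous
  have hc : Continuous ↿(fun d θ : ℝ => φ (1 / 2 + d * sin θ)) := by
    change Continuous fun z : ℝ × ℝ => φ (1 / 2 + z.1 * sin z.2)
    fun_prop
  have hc' : Continuous ↿(fun d θ : ℝ => sin θ * deriv φ (1 / 2 + d * sin θ)) := by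
    change Continuous fun z : ℝ × ℝ => sin z.2 * deriv φ (1 / 2 + z.1 * sin z.2)
    fun_prop
  have hd : ∀ d θ : ℝ, HasDerivAt (fun d => φ (1 / 2 + d * sin θ))
      (sin θ * deriv φ (1 / 2 + d * sin θ)) d := by
    intro d θ
    have h := ((hφ.differentiable one_ne_zero (1 / 2 + d * sin θ)).hasDerivAt).comp d
      (((hasDerivAt_id d).mul_const (sin θ)).const_add (1 / 2))
    exact h.congr_deriv (by ring)
  constructor
  · exact (contDiff_parametric_primitive hc hc' hd (c := c)).contDiffAt.comp (p, q)
      (contDiffAt_polar (p, q) hq)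
  · have h := (hasStrictFDerivAt_parametric_primitive hc hc' hd (c := c)
      (polarRadius p q, polarAngle p q)).hasFDerivAt.comp_hasDerivAt q (hasDerivAt_polar p hq)
    exact h.congr_deriv (by simp)

lemma Tplus_contDiffAt_hasDerivAt {p q : ℝ} (hp : p ∈ Set.Ioo 0 pstar) (hq : 0 < q) :
    ContDiffAt ℝ 1 (fun z : ℝ × ℝ => Tplus z.1 z.2) (p, q) ∧
      ∃ D < 0, HasDerivAt (Tplus p) D q := by
  have hp0 := hp.1
  have hpi := Real.pi_pos
  obtain ⟨φ, hφ, hφeq, hφ'⟩ := exists_contDiff_extension_inv_sqrt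
    (show 0 < p ^ 2 / 2 by positivity)
  obtain ⟨hc, hd⟩ := angular_integral_contDiffAt_hasDerivAt hφ (π / 2) p hq
  have heq : ∀ z : ℝ × ℝ, z.1 ∈ Set.Ioo 0 pstar → 0 < z.2 → p ^ 2 / 2 < z.1 ^ 2 →
      Tplus z.1 z.2 =
        -∫ θ in π / 2..polarAngle z.1 z.2, φ (1 / 2 + polarRadius z.1 z.2 * sin θ) := by
    intro z h1 h2 h3
    obtain ⟨h4, h5⟩ := polarAngle_mem h1 h2
    rw [Tplus_eq h1 h2, intervalIntegral.integral_symm (π / 2)]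
    congr 1
    refine intervalIntegral.integral_congr fun θ hθ => (hφeq _ ?_).symm
    rw [Set.uIcc_of_ge (by linarith)] at hθ
    have h6 := Real.sin_le_sin_of_le_of_le_pi_div_two h4.le hθ.2 hθ.1
    have h7 := mul_le_mul_of_nonneg_left h6 (polarRadius_pos z.1 h2).le
    linarith [half_add_mul_sin_polarAngle z.1 h2]
  have hev : ∀ᶠ z : ℝ × ℝ in 𝓝 (p, q), z.1 ∈ Set.Ioo 0 pstar ∧ 0 < z.2 ∧ p ^ 2 / 2 < z.1 ^ 2 :=
    (continuousAt_fst.eventually_mem (isOpen_Ioo.mem_nhds hp)).and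
      ((continuousAt_snd.eventually_mem (Ioi_mem_nhds hq)).and
        ((by fun_prop : ContinuousAt (fun z : ℝ × ℝ => z.1 ^ 2) (p, q)).eventually_mem
          (isOpen_Ioi.mem_nhds (by simp; positivity))))
  have hp2 : p ^ 2 / 2 < p ^ 2 := by linarith [pow_pos hp0 2]
  refine ⟨hc.neg.congr_of_eventuallyEq (hev.mono fun z hz => heq z hz.1 hz.2.1 hz.2.2), _, ?_,
    hd.neg.congr_of_eventuallyEq ?_⟩
  · obtain ⟨h4, h5⟩ := polarAngle_mem hp hq
    have h6 := half_add_mul_sin_polarAngle p hq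
    refine neg_lt_zero.2 (upper_angular_deriv_pos hφ (polarRadius_pos p hq) h4 h5 ?_ ?_)
    · exact fun y hy => hφ' y (by linarith)
    · have := polarRadius_pos p hq
      rw [hφeq _ (by linarith [sq_lt_half hp])]
      have : 0 < √(1 / 2 + polarRadius p q) := Real.sqrt_pos.2 (by linarith)
      positivity
  · filter_upwards [Ioi_mem_nhds hq] with x hx using heq (p, x) hp hx hp2

lemma Tminus_contDiffAt_hasDerivAt {p q : ℝ} (hp : p ∈ Set.Ioo 0 pstar)
    (hq : q ∈ Set.Ioo 0 √(A p)) :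
    ContDiffAt ℝ 1 (fun z : ℝ × ℝ => Tminus z.1 z.2) (p, q) ∧
      ∃ D > 0, HasDerivAt (Tminus p) D q := by
  have hp0 := hp.1
  have hpi := Real.pi_pos
  have hlt := polarRadius_lt_half hq
  obtain ⟨m, hm0, hm⟩ := exists_between (sub_pos.2 hlt)
  obtain ⟨φ, hφ, hφeq, hφ'⟩ := exists_contDiff_extension_inv_sqrt hm0
  obtain ⟨hc, hd⟩ := angular_integral_contDiffAt_hasDerivAt hφ (-(π / 2)) p hq.1
  have heq : ∀ z : ℝ × ℝ, z.1 ∈ Set.Ioo 0 pstar → 0 < z.2 → m < 1 / 2 - polarRadius z.1 z.2 →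
      Tminus z.1 z.2 =
        ∫ θ in -(π / 2)..polarAngle z.1 z.2, φ (1 / 2 + polarRadius z.1 z.2 * sin θ) := by
    intro z h1 h2 h3
    rw [Tminus_eq h1 h2 (by linarith)]
    refine intervalIntegral.integral_congr fun θ _ => (hφeq _ ?_).symm
    have := mul_le_mul_of_nonneg_left (Real.neg_one_le_sin θ) (polarRadius_pos z.1 h2).le
    linarith
  have hcont : Continuous fun z : ℝ × ℝ => 1 / 2 - polarRadius z.1 z.2 := by
    unfold polarRadius
    fun_prop
  have hev : ∀ᶠ z : ℝ × ℝ in 𝓝 (p, q),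
      z.1 ∈ Set.Ioo 0 pstar ∧ 0 < z.2 ∧ m < 1 / 2 - polarRadius z.1 z.2 :=
    (continuousAt_fst.eventually_mem (isOpen_Ioo.mem_nhds hp)).and
      ((continuousAt_snd.eventually_mem (Ioi_mem_nhds hq.1)).and
        (hcont.continuousAt.eventually_mem (isOpen_Ioi.mem_nhds hm)))
  refine ⟨hc.congr_of_eventuallyEq (hev.mono fun z hz => heq z hz.1 hz.2.1 hz.2.2), _, ?_,
    hd.congr_of_eventuallyEq ?_⟩
  · obtain ⟨h4, h5⟩ := polarAngle_mem hp hq.1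
    refine lower_angular_deriv_pos (polarRadius_pos p hq.1) h4 h5 ?_ ?_
    · exact fun y hy => hφ' y (by linarith)
    · have := mul_le_mul_of_nonneg_left (Real.neg_one_le_sin (polarAngle p q))
        (polarRadius_pos p hq.1).le
      rw [hφeq _ (by linarith), half_add_mul_sin_polarAngle p hq.1, Real.sqrt_sq hp0.le]
      positivity
  · have := (Continuous.prodMk_right p).tendsto q |>.eventually hev
    filter_upwards [this] with x hx using heq (p, x) hp hx.2.1 hx.2.2

/-- The implicit function theorem for a scalar equation: a locally unique solution branch of a
`C¹` equation with nonvanishing derivative in the unknown is `C¹`. -/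
lemma contDiffAt_of_locally_unique_solution {G : ℝ × ℝ → ℝ} {f : ℝ → ℝ} {p D : ℝ}
    (hG : ContDiffAt ℝ 1 G (p, f p)) (hD : HasDerivAt (fun b => G (p, b)) D (f p)) (hD0 : D ≠ 0)
    (h0 : G (p, f p) = 0) (huniq : ∀ᶠ z in 𝓝 (p, f p), G z = 0 → z.2 = f z.1) :
    ContDiffAt ℝ 1 f p := by
  have hinv : (fderiv ℝ G (p, f p) ∘L .inr ℝ ℝ ℝ).IsInvertible := by
    have h1 : fderiv ℝ G (p, f p) (0, 1) = D :=
      (((hG.differentiableAt one_ne_zero).hasFDerivAt.comp_hasDerivAt (f p)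
        ((hasDerivAt_const (f p) p).prodMk (hasDerivAt_id (f p)))).unique hD)
    refine ⟨ContinuousLinearEquiv.unitsEquivAut ℝ (Units.mk0 D hD0), ?_⟩
    ext
    simp [h1]
  have hψ := hG.contDiffAt_implicitFunction one_ne_zero hinv
  have hψp : hG.implicitFunction one_ne_zero hinv p = f p :=
    hG.implicitFunction_apply_self one_ne_zero hinv
  have hψ0 := hG.eventually_apply_implicitFunction one_ne_zero hinv
  refine hψ.congr_of_eventuallyEq ?_
  have hcont : ContinuousAt (fun x => (x, hG.implicitFunction one_ne_zero hinv x)) p :=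
    continuousAt_id.prodMk hψ.continuousAt
  have htend : Tendsto (fun x => (x, hG.implicitFunction one_ne_zero hinv x)) (𝓝 p)
      (𝓝 (p, f p)) := by
    simpa only [hψp] using hcont.tendsto
  filter_upwards [htend.eventually huniq, hψ0] with x hx hx0
  exact (hx (hx0.trans h0)).symm

/-- fix `N ≥ 2`, `1 ≤ K ≤ N−1`, and let `q₁, q_N : (0, p⋆) → ℝ` select, for each
`p₀ ∈ (0, p⋆)`, the unique pair with `q₁(p₀) > 0`, `q_N(p₀) ∈ (0, √A(p₀))` solving
`T₊(p₀, q₁(p₀)) = T₋(p₀, q_N(p₀))` and `2Kq₁(p₀) − 2(N−K)q_N(p₀) = √A(p₀)`. Then the maps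
`p₀ ↦ q₁(p₀)`, `p₀ ↦ q_N(p₀)` and `p₀ ↦ T₊(p₀, q₁(p₀))` are `C¹` on `(0, p⋆)`. -/
theorem Ksplit_maps_C1 (N K : ℕ) (hN : 2 ≤ N) (hK1 : 1 ≤ K) (hKN : K ≤ N - 1)
    (q₁ qN : ℝ → ℝ)
    (hsol : ∀ p₀ ∈ Set.Ioo 0 pstar,
      0 < q₁ p₀ ∧ qN p₀ ∈ Set.Ioo 0 (Real.sqrt (A p₀)) ∧
      Tplus p₀ (q₁ p₀) = Tminus p₀ (qN p₀) ∧
      2 * (K : ℝ) * q₁ p₀ - 2 * ((N : ℝ) - (K : ℝ)) * qN p₀ = Real.sqrt (A p₀))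
    (huniq : ∀ p₀ ∈ Set.Ioo 0 pstar, ∀ a b : ℝ,
      0 < a → b ∈ Set.Ioo 0 (Real.sqrt (A p₀)) →
      Tplus p₀ a = Tminus p₀ b →
      2 * (K : ℝ) * a - 2 * ((N : ℝ) - (K : ℝ)) * b = Real.sqrt (A p₀) →
      a = q₁ p₀ ∧ b = qN p₀) :
    ContDiffOn ℝ 1 q₁ (Set.Ioo 0 pstar) ∧
    ContDiffOn ℝ 1 qN (Set.Ioo 0 pstar) ∧
    ContDiffOn ℝ 1 (fun p₀ => Tplus p₀ (q₁ p₀)) (Set.Ioo 0 pstar) := by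
  have hK0 : (0 : ℝ) < K := by exact_mod_cast hK1
  have hNK : (0 : ℝ) < (N : ℝ) - K := by
    have : K < N := by omega
    exact sub_pos.2 (by exact_mod_cast this)
  set a : ℝ × ℝ → ℝ := fun z => (√(A z.1) + 2 * ((N : ℝ) - K) * z.2) / (2 * K) with ha
  have haq : ∀ p ∈ Set.Ioo 0 pstar, a (p, qN p) = q₁ p := by
    intro p hp
    have := (hsol p hp).2.2.2
    simp only [ha]
    rw [div_eq_iff (by positivity)]
    linarith
  have hAc : Continuous A := by unfold A; fun_prop
  have hac : ∀ p ∈ Set.Ioo 0 pstar, ContDiffAt ℝ 1 a (p, qN p) := by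
    intro p hp
    have hA : ContDiffAt ℝ 1 (fun z : ℝ × ℝ => A z.1) (p, qN p) := by unfold A; fun_prop
    exact ((hA.sqrt (A_pos hp).ne').add (by fun_prop)).div_const _
  have hTa : ∀ p ∈ Set.Ioo 0 pstar,
      ContDiffAt ℝ 1 (fun z => Tplus z.1 (a z)) (p, qN p) := by
    intro p hp
    refine ContDiffAt.comp (p, qN p) (g := fun z : ℝ × ℝ => Tplus z.1 z.2)
      (f := fun z => (z.1, a z)) ?_ (contDiffAt_fst.prodMk (hac p hp))
    rw [haq p hp]
    exact (Tplus_contDiffAt_hasDerivAt hp (hsol p hp).1).1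
  have hN : ∀ p ∈ Set.Ioo 0 pstar, ContDiffAt ℝ 1 qN p := by
    intro p hp
    obtain ⟨hq₁, hqN, hT, -⟩ := hsol p hp
    obtain ⟨-, D₁, hD₁, hd₁⟩ := Tplus_contDiffAt_hasDerivAt hp hq₁
    obtain ⟨hc₂, D₂, hD₂, hd₂⟩ := Tminus_contDiffAt_hasDerivAt hp hqN
    have hda : HasDerivAt (fun b => a (p, b)) (2 * ((N : ℝ) - K) * 1 / (2 * K)) (qN p) :=
      (((hasDerivAt_id (qN p)).const_mul (2 * ((N : ℝ) - K))).const_add √(A p)).div_const _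
    have hslope : 0 < 2 * ((N : ℝ) - K) * 1 / (2 * K) := by positivity
    rw [← haq p hp] at hd₁
    have hdiff : HasDerivAt (fun b => Tplus p (a (p, b)) - Tminus p b)
        (D₁ * (2 * ((N : ℝ) - K) * 1 / (2 * K)) - D₂) (qN p) :=
      (HasDerivAt.comp (h₂ := Tplus p) (qN p) hd₁ hda).sub hd₂
    refine contDiffAt_of_locally_unique_solution
      (G := fun z => Tplus z.1 (a z) - Tminus z.1 z.2) ((hTa p hp).sub hc₂)
      hdiff ?_ ?_ ?_
    · have := mul_neg_of_neg_of_pos hD₁ hslope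
      linarith
    · simp only [haq p hp, hT, sub_self]
    · have hb : ∀ᶠ z : ℝ × ℝ in 𝓝 (p, qN p), z.2 < √(A z.1) :=
        continuousAt_snd.eventually_lt
          (by fun_prop : Continuous fun z : ℝ × ℝ => √(A z.1)).continuousAt hqN.2
      filter_upwards [continuousAt_fst.eventually_mem (isOpen_Ioo.mem_nhds hp),
        continuousAt_snd.eventually_mem (Ioi_mem_nhds hqN.1), hb,
        (hac p hp).continuousAt.eventually_mem (Ioi_mem_nhds (hq₁.trans_eq (haq p hp).symm))]
        with z h1 h2 h3 h4 h5
      refine (huniq z.1 h1 (a z) z.2 h4 ⟨h2, h3⟩ (sub_eq_zero.1 h5) ?_).2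
      simp only [ha]
      field_simp
      ring
  have hcurve : ∀ p ∈ Set.Ioo 0 pstar, ContDiffAt ℝ 1 (fun x => (x, qN x)) p := fun p hp =>
    contDiffAt_id.prodMk (hN p hp)
  refine ⟨fun p hp => ?_, fun p hp => (hN p hp).contDiffWithinAt, fun p hp => ?_⟩
  · refine (((hac p hp).comp p (hcurve p hp)).congr_of_eventuallyEq ?_).contDiffWithinAt
    filter_upwards [isOpen_Ioo.mem_nhds hp] with x hx using (haq x hx).symm
  · refine (((hTa p hp).comp p (hcurve p hp)).congr_of_eventuallyEq ?_).contDiffWithinAt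
    filter_upwards [isOpen_Ioo.mem_nhds hp] with x hx
    simp only [Function.comp, haq x hx]
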